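/- Let 𝒯 be the formal ℚ-linear combination of elements of F given by 𝒯 := 3·[ (ρ_{1,2}ρ_{3,4})/(ρ_{1,4}ρ_{3,2}) ] − 3·[ R3(14|259,370) ] − 3·[ R3(54|179,260) ] + [ R3(14|257,369) ] + [ R3(14|259,376) ] − [ R3(94|150,276) ] − [ R3(94|157,260) ] − [ CR(154|2769) ] + [ CR(194|2570) ]. Then Σ_{σ ∈ S_{{1,2,3}} × S_{{5,6,7}}} sgn(σ) · S^⧢ Li_3( σ(𝒯) ) = 0 in V_F^{⊗3}, where σ ranges over the permutations of the vectors that permute v_1, v_2, v_3 among themselves and v_5, v_6, v_7 among themselves, and S^⧢ Li_3 is extended ℚ-linearly to formal combinations. -/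

import Mathlib

open scoped TensorProduct
open PiTensorProduct

attribute [local instance] Classical.propDecidable

set_option maxHeartbeats 1000000
set_option synthInstance.maxHeartbeats 400000

noncomputable section

namespace GrassPoly

variable (F : Type) [Field F]

/-- `V_F = F^× ⊗_ℤ ℚ` as a `ℚ`-vector space. -/
abbrev VF : Type := ℚ ⊗[ℤ] (Additive Fˣ)

variable {F}

/-- The class `[a]` of a nonzero field element in `V_F` (defined to be `0` for `a = 0`). -/
def cls (a : F) : VF F :=
  if h : a = 0 then 0 else (1 : ℚ) ⊗ₜ[ℤ] (Additive.ofMul (Units.mk0 a h))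

variable (F) in
/-- Tensor powers of V_F over ℚ. -/
abbrev TP (n : ℕ) : Type := ⨂[ℚ]^n (VF F)

instance instTPAddCommGroup (n : ℕ) : AddCommGroup (TP F n) :=
  Module.addCommMonoidToAddCommGroup ℚ

/-- Appending one extra tensor factor on the right. -/
def snoc {n : ℕ} : TP F n →ₗ[ℚ] VF F →ₗ[ℚ] TP F (n + 1) :=
  PiTensorProduct.lift
    ((PiTensorProduct.tprod ℚ (s := fun _ : Fin (n + 1) => VF F)).curryRight)

/-- The factor `t_i` appearing in the recursive definition of the symbol,
as a function of `(a_{i-1}, a_i, a_{i+1})`. -/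
def tCoef (p a q : F) : VF F :=
  if p = a then (if a = q then 0 else cls (q - a))
  else if a = q then - cls (p - a)
  else cls ((q - a) / (p - a))

/-- The symbol `S I(a₀; a₁, …, a_m; a_{m+1})`, with the middle entries given as a list
(of length `n`). -/
def SIaux : (n : ℕ) → (a0 : F) → (as : List F) → (b : F) → as.length = n → TP F n
  | 0, _, _, _, _ => tprod ℚ (fun i : Fin 0 => i.elim0)
  | n + 1, a0, as, b, h =>
      ∑ i : Fin (n + 1),
        snoc (SIaux n a0 (as.eraseIdx i.val) b
            (by
              have hi' := i.isLt
              have hi : i.val < as.length := by omega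
              have h2 := List.length_eraseIdx_of_lt hi
              omega))
          (tCoef ((a0 :: as).getD i.val 0) (as.getD i.val 0) ((as ++ [b]).getD (i.val + 1) 0))

/-- Cyclic rotation `b₁ ⊗ … ⊗ b_N ↦ b₂ ⊗ … ⊗ b_N ⊗ b₁` on tensor powers. -/
def rotN (n : ℕ) : TP F n ≃ₗ[ℚ] TP F n :=
  PiTensorProduct.reindex ℚ (fun _ : Fin n => VF F) (finRotate n).symm

/-- Splitting off the last tensor factor. -/
def splitLast (n : ℕ) : TP F (n + 1) ≃ₗ[ℚ] (TP F n) ⊗[ℚ] (VF F) :=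
  ((PiTensorProduct.reindex ℚ (fun _ : Fin (n + 1) => VF F)
      (finSumFinEquiv (m := n) (n := 1)).symm).trans
    (PiTensorProduct.tmulEquiv ℚ (VF F)).symm).trans
    (TensorProduct.congr (LinearEquiv.refl ℚ _)
      (PiTensorProduct.subsingletonEquiv (0 : Fin 1)))

/-- The projector `Π̃_N` annihilating symbols of products. -/
def Pit : (n : ℕ) → TP F n →ₗ[ℚ] TP F n
  | 0 => LinearMap.id
  | 1 => LinearMap.id
  | (n + 2) =>
      ((splitLast (n + 1)).symm.toLinearMap
        ∘ₗ TensorProduct.map (Pit (n + 1)) LinearMap.id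
        ∘ₗ (splitLast (n + 1)).toLinearMap)
      ∘ₗ ((LinearMap.id : TP F (n + 2) →ₗ[ℚ] TP F (n + 2)) - (rotN (F := F) (n + 2)).toLinearMap)

/-- The map on `V_F` induced by a field automorphism. -/
def vmap (φ : F ≃+* F) : VF F →ₗ[ℚ] VF F :=
  TensorProduct.AlgebraTensorModule.map (LinearMap.id : ℚ →ₗ[ℚ] ℚ)
    (AddMonoidHom.toIntLinearMap
      { toFun := fun a => Additive.ofMul ((Units.map (φ : F →* F)) a.toMul)
        map_zero' := by simp
        map_add' := by intro a b; simp [_root_.map_mul] })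

/-- The induced map on tensor powers. -/
def tpMap {n : ℕ} (φ : F ≃+* F) : TP F n →ₗ[ℚ] TP F n :=
  PiTensorProduct.map (fun _ => vmap φ)


/-! ### Symbols of (multiple) polylogarithms -/

/-- Symbol of `Li₂`. -/
def SLi2 (x : F) : TP F 2 := - SIaux 2 0 [x⁻¹, 0] 1 rfl

/-- Symbol of `Li₃`. -/
def SLi3 (x : F) : TP F 3 := - SIaux 3 0 [x⁻¹, 0, 0] 1 rfl

/-- Symbol of `Li₄`. -/
def SLi4 (x : F) : TP F 4 := - SIaux 4 0 [x⁻¹, 0, 0, 0] 1 rfl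

/-- Symbol of `Li₅`. -/
def SLi5 (x : F) : TP F 5 := - SIaux 5 0 [x⁻¹, 0, 0, 0, 0] 1 rfl

/-- Symbol of `I_{3,1}(x,y) = I(0; x,0,0,y; 1)`. -/
def SI31 (x y : F) : TP F 4 := SIaux 4 0 [x, 0, 0, y] 1 rfl

/-- Symbol of `I_{4,1}(x,y) = I(0; x,0,0,0,y; 1)`. -/
def SI41 (x y : F) : TP F 5 := SIaux 5 0 [x, 0, 0, 0, y] 1 rfl

/-- Symbol of `I⁺_{4,1}(x,y) = ½ (I_{4,1}(x,y) + I_{4,1}(x,y⁻¹))`. -/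
def I41p (x y : F) : TP F 5 := (2 : ℚ)⁻¹ • (SI41 x y + SI41 x y⁻¹)

/-- The anharmonic orbit of `x`, together with the signs of the
corresponding permutations in `S₃`. -/
def anhList (x : F) : List (ℚ × F) :=
  [(1, x), (1, (1 - x)⁻¹), (1, 1 - x⁻¹), (-1, x⁻¹), (-1, 1 - x), (-1, x / (x - 1))]

/-- Symbol of `Ĩ_{3,1}(x,y) = (1/36) Σ_{σ,π ∈ S₃} sgn(σ) sgn(π) I_{3,1}(x^σ, y^π)`. -/
def tI31 (x y : F) : TP F 4 :=
  (36 : ℚ)⁻¹ •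
    ((anhList x).map (fun p =>
      ((anhList y).map (fun q => (p.1 * q.1) • SI31 p.2 q.2)).sum)).sum

/-- Symbol of `Ĩ⁺_{4,1}(x,y) = (1/6) Σ_{σ ∈ S₃} sgn(σ) I⁺_{4,1}(x^σ, y)`. -/
def tI41p (x y : F) : TP F 5 :=
  (6 : ℚ)⁻¹ • ((anhList x).map (fun p => p.1 • I41p p.2 y)).sum

/-- Symbol of `V(z; x, y) = Ĩ_{3,1}(z, [x]+[y]+[(1-x)/(1-xy)]+[1-xy]+[(1-y)/(1-xy)])`. -/
def Vc (z x y : F) : TP F 4 :=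
  tI31 z x + tI31 z y + tI31 z ((1 - x) / (1 - x * y)) + tI31 z (1 - x * y)
    + tI31 z ((1 - y) / (1 - x * y))

/-- `Sym₃₆(a,b) := I_{3,1}(a,b) - Ĩ_{3,1}(a,b)` (on the level of symbols). -/
def S36 (a b : F) : TP F 4 := SI31 a b - tI31 a b

/-! ### Generic vectors -/

variable (N m : ℕ)

/-- Polynomial ring on the entries of `N` generic vectors in `m`-space. -/
abbrev Pol : Type := MvPolynomial (Fin N × Fin m) ℚ

/-- The field of rational functions in the entries of `N` generic vectors in `m`-space. -/
abbrev FF : Type := FractionRing (Pol N m)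

/-- The `j`-th coordinate of the `i`-th generic vector. -/
def gen (i : Fin N) (j : Fin m) : FF N m :=
  algebraMap (Pol N m) (FF N m) (MvPolynomial.X (i, j))

/-- `⟨i₁ … i_m⟩`: the determinant of the matrix whose columns are
the generic vectors selected by `cols`. -/
def dets (cols : Fin m → Fin N) : FF N m :=
  (Matrix.of fun r c => gen N m (cols c) r).det

/-- The field automorphism of `FF N m` induced by a permutation of the `N` vectors. -/
def permAut (σ : Equiv.Perm (Fin N)) : FF N m ≃+* FF N m :=
  IsFractionRing.ringEquivOfRingEquiv
    ((MvPolynomial.renameEquiv ℚ (σ.prodCongr (Equiv.refl (Fin m)))).toRingEquiv)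

variable {N m}

/-- Skew-symmetrization over all permutations of the `N` generic vectors. -/
def Alt {n : ℕ} (x : TP (FF N m) n) : TP (FF N m) n :=
  ∑ σ : Equiv.Perm (Fin N), (((Equiv.Perm.sign σ : ℤˣ) : ℤ) : ℚ) • tpMap (permAut N m σ) x

end GrassPoly

end

namespace GrassPoly

noncomputable section W5

/-- The field of rational functions in the entries of 10 generic vectors in 5-space. -/
abbrev K5 : Type := FF 10 5

/-- The vector label `k ∈ {1, …, 9, 0}` as an index (`0` stands for the 10th vector). -/
def L10 (k : ℕ) : Fin 10 := ⟨(k + 9) % 10, Nat.mod_lt _ (by norm_num)⟩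

/-- `⟨abcde⟩` for vector labels in `{1, …, 9, 0}`. -/
def d5 (a b c d e : ℕ) : K5 := dets 10 5 ![L10 a, L10 b, L10 c, L10 d, L10 e]

/-- Vector labels taken mod 8 in `{1, …, 8}`. -/
def M8 (j : ℕ) : ℕ := (j - 1) % 8 + 1

/-- `ρ_i = ρ_{i,i+1,i+2,i+3} = ⟨i,i+1,i+2,i+3,9⟩ / ⟨i,i+1,i+2,i+3,0⟩`, indices mod 8. -/
def rho5 (i : ℕ) : K5 :=
  d5 (M8 i) (M8 (i + 1)) (M8 (i + 2)) (M8 (i + 3)) 9 /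
    d5 (M8 i) (M8 (i + 1)) (M8 (i + 2)) (M8 (i + 3)) 0

/-- `ρ_{i,j} = ρ_i - ρ_j`. -/
def rr5 (i j : ℕ) : K5 := rho5 i - rho5 j

/-- The projected cross-ratio `CR(abc|defg) = ⟨abcdf⟩⟨abceg⟩ / (⟨abcdg⟩⟨abcef⟩)`. -/
def CR5 (a b c d e f g : ℕ) : K5 :=
  (d5 a b c d f * d5 a b c e g) / (d5 a b c d g * d5 a b c e f)

/-- The projected triple-ratio
`R₃(ab|cde,fgh) = ⟨abcdf⟩⟨abceh⟩⟨abdeg⟩ / (⟨abcdg⟩⟨abcef⟩⟨abdeh⟩)`. -/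
def R3 (a b c d e f g h : ℕ) : K5 :=
  (d5 a b c d f * d5 a b c e h * d5 a b d e g) /
    (d5 a b c d g * d5 a b c e f * d5 a b d e h)

/-- The symbol `S(Gr₅) = -2·(5!)²·Alt₁₀ [⟨12345⟩ ⊗ ⟨23456⟩ ⊗ ⟨34567⟩ ⊗ ⟨45678⟩ ⊗ ⟨56789⟩]`. -/
def SGr5 : TP K5 5 :=
  ((-2 : ℚ) * ((Nat.factorial 5 : ℚ)) ^ 2) •
    Alt (tprod ℚ ![cls (d5 1 2 3 4 5), cls (d5 2 3 4 5 6), cls (d5 3 4 5 6 7),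
      cls (d5 4 5 6 7 8), cls (d5 5 6 7 8 9)])

end W5

end GrassPoly

open GrassPoly

namespace GrassPoly

/-- The formal ℚ-linear combination `𝒯`. -/
noncomputable def Tcal : List (ℚ × K5) :=
  [ (3, rr5 1 2 * rr5 3 4 / (rr5 1 4 * rr5 3 2)),
    (-3, R3 1 4 2 5 9 3 7 0),
    (-3, R3 5 4 1 7 9 2 6 0),
    (1, R3 1 4 2 5 7 3 6 9),
    (1, R3 1 4 2 5 9 3 7 6),
    (-1, R3 9 4 1 5 0 2 7 6),
    (-1, R3 9 4 1 5 7 2 6 0),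
    (-1, CR5 1 5 4 2 7 6 9),
    (1, CR5 1 9 4 2 5 7 0) ]

/-- Membership in the subgroup `S_{{1,2,3}} × S_{{5,6,7}}` of `S₁₀` (0-indexed: the
permutations preserving `{0,1,2}` and `{4,5,6}` and fixing everything else). -/
def fixSets (σ : Equiv.Perm (Fin 10)) : Prop :=
  (∀ i : Fin 10, i.val < 3 → (σ i).val < 3) ∧
  (∀ i : Fin 10, 4 ≤ i.val → i.val < 7 → (4 ≤ (σ i).val ∧ (σ i).val < 7)) ∧
  (∀ i : Fin 10, ¬ i.val < 3 → ¬ (4 ≤ i.val ∧ i.val < 7) → σ i = i)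

/-! ### Multiplicative letters, named by lists of vector labels -/

/-- Conditional exchange of the entries in positions `k` and `k + 1`. -/
def exch : ℕ → List ℕ → List ℕ
  | 0, x :: y :: l => bif Nat.blt y x then y :: x :: l else x :: y :: l
  | k + 1, x :: l => x :: exch k l
  | _, l => l

/-- Positions of adjacent exchanges which sort the interchangeable labels of a letter. -/
def sortingNetwork : ℕ → List ℕ
  | 5 => [0, 1, 2, 3, 0, 1, 2, 0, 1, 0]
  | 8 => [0, 2, 4, 6]
  | 9 => [0, 1, 0, 4, 5, 4]
  | _ => []

/-- The normal form of a letter. -/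
def canonLetter (l : List ℕ) : List ℕ :=
  (sortingNetwork l.length).foldl (fun l k => exch k l) l

/-- Equality test for lists of labels. -/
def eqLabels : List ℕ → List ℕ → Bool
  | [], [] => true
  | x :: l, y :: m => Nat.beq x y && eqLabels l m
  | _, _ => false

/-- The letters occurring in the functional equation, in normal form. -/
def letters : List (List ℕ) :=
  [[],
   [0, 1, 2, 4, 9], [0, 1, 3, 4, 9], [0, 1, 4, 5, 9], [0, 1, 4, 6, 9], [0, 1, 4, 7, 9],
   [0, 2, 3, 4, 9], [0, 2, 4, 5, 9], [0, 2, 4, 6, 9], [0, 2, 4, 7, 9], [0, 3, 4, 5, 9],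
   [0, 3, 4, 6, 9], [0, 3, 4, 7, 9], [0, 4, 5, 6, 9], [0, 4, 5, 7, 9], [0, 4, 6, 7, 9],
   [1, 2, 3, 4, 5], [1, 2, 3, 4, 6], [1, 2, 3, 4, 7], [1, 2, 3, 4, 9], [1, 2, 4, 5, 6],
   [1, 2, 4, 5, 7], [1, 2, 4, 5, 9], [1, 2, 4, 6, 7], [1, 2, 4, 6, 9], [1, 2, 4, 7, 9],
   [1, 3, 4, 5, 6], [1, 3, 4, 5, 7], [1, 3, 4, 5, 9], [1, 3, 4, 6, 7], [1, 3, 4, 6, 9],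
   [1, 3, 4, 7, 9], [1, 4, 5, 6, 7], [1, 4, 5, 6, 9], [1, 4, 5, 7, 9], [1, 4, 6, 7, 9],
   [2, 3, 4, 5, 6], [2, 3, 4, 5, 7], [2, 3, 4, 5, 9], [2, 3, 4, 6, 7], [2, 3, 4, 6, 9],
   [2, 3, 4, 7, 9], [2, 4, 5, 6, 7], [2, 4, 5, 6, 9], [2, 4, 5, 7, 9], [2, 4, 6, 7, 9],
   [3, 4, 5, 6, 7], [3, 4, 5, 6, 9], [3, 4, 5, 7, 9], [3, 4, 6, 7, 9], [4, 5, 6, 7, 9],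
   [1, 4, 2, 3, 5, 6, 0, 9], [1, 4, 2, 3, 5, 6, 7, 9], [1, 4, 2, 3, 5, 7, 0, 9],
   [1, 4, 2, 3, 5, 7, 6, 9], [1, 4, 2, 3, 6, 7, 0, 9], [1, 4, 2, 3, 6, 7, 5, 9],
   [2, 4, 1, 3, 5, 6, 0, 9], [2, 4, 1, 3, 5, 6, 7, 9], [2, 4, 1, 3, 5, 7, 0, 9],
   [2, 4, 1, 3, 5, 7, 6, 9], [2, 4, 1, 3, 6, 7, 0, 9], [2, 4, 1, 3, 6, 7, 5, 9],
   [3, 4, 1, 2, 5, 6, 0, 9], [3, 4, 1, 2, 5, 6, 7, 9], [3, 4, 1, 2, 5, 7, 0, 9],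
   [3, 4, 1, 2, 5, 7, 6, 9], [3, 4, 1, 2, 6, 7, 0, 9], [3, 4, 1, 2, 6, 7, 5, 9],
   [4, 5, 1, 2, 6, 7, 0, 9], [4, 5, 1, 3, 6, 7, 0, 9], [4, 5, 2, 3, 6, 7, 0, 9],
   [4, 6, 1, 2, 5, 7, 0, 9], [4, 6, 1, 3, 5, 7, 0, 9], [4, 6, 2, 3, 5, 7, 0, 9],
   [4, 7, 1, 2, 5, 6, 0, 9], [4, 7, 1, 3, 5, 6, 0, 9], [4, 7, 2, 3, 5, 6, 0, 9],
   [4, 9, 1, 2, 5, 6, 0, 7], [4, 9, 1, 2, 5, 7, 0, 6], [4, 9, 1, 2, 6, 7, 0, 5],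
   [4, 9, 1, 3, 5, 6, 0, 7], [4, 9, 1, 3, 5, 7, 0, 6], [4, 9, 1, 3, 6, 7, 0, 5],
   [4, 9, 2, 3, 5, 6, 0, 7], [4, 9, 2, 3, 5, 7, 0, 6], [4, 9, 2, 3, 6, 7, 0, 5],
   [1, 2, 3, 4, 5, 6, 7, 9, 0]]

/-- The letter with a given index. -/
def letterAt (i : ℕ) : List ℕ := letters.getD i []

/-- The position of a letter in a list, or the length of the list if it is absent. -/
def indexIn (l : List ℕ) : List (List ℕ) → ℕ
  | [] => 0
  | m :: ms => bif eqLabels l m then 0 else Nat.succ (indexIn l ms)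

/-- The index of a letter. -/
def letterIndex (l : List ℕ) : ℕ := indexIn (canonLetter l) letters

/-- The transposition of the labels `p` and `p + 1`. -/
def swapLabel (p x : ℕ) : ℕ :=
  bif Nat.beq x p then p + 1 else bif Nat.beq x (p + 1) then p else x

/-- The generating transpositions `(p, p + 1)`, `p ∈ {1, 2, 5, 6}`, with their actions on letter
indices; the image of the index `i` is the `i`-th digit in base `128`. -/
def table : ℕ → ℕ
  | 1 => 186224376546989894485008865843472814218031296315039384273875441754876240384249029558428869752357869598416167177757594728010024908634348159737977083334822391134447708451698504874831478912
  | 2 => 186274562742235702617953723040272423910936847263244407814855797348432245586773897381714887397215781616728855616297285522502879507632957063778719120033713572640901595249155612340350107904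
  | 5 => 186258094368399616318963671721212426877242629349197130109694472451922805093997916309467021111499719051683069614196851247259140529547832326524149755482389829514984119855458349124771938432
  | 6 => 186274434106808804091386320940986904832240471495910741129095477536649595997033994810018564656712281049095837721218047129334680167627754624846123818731987879272083582649429916207800156288
  | _ => 0

/-- Digits in base `128`. -/
def digit (t i : ℕ) : ℕ := Nat.mod (Nat.div t (Nat.pow 128 i)) 128

/-! ### Formal combinations of words -/

/-- Applies a function to a natural number that has been evaluated to a literal. -/
def forced {α : Type} (f : ℕ → α) : ℕ → α
  | 0 => f 0
  | n + 1 => f (n + 1)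

/-- The code of a word in three letters. -/
def wordCode (i j k : ℕ) : ℕ := Nat.add i (Nat.mul 128 (Nat.add j (Nat.mul 128 k)))

/-- A search tree of word codes with integral coefficients. -/
inductive WordTree
  | leaf : WordTree
  | node : WordTree → ℕ → ℤ → WordTree → WordTree

/-- Tests whether an integer vanishes. -/
def intIsZero : ℤ → Bool
  | Int.ofNat n => Nat.beq n 0
  | Int.negSucc _ => false

namespace WordTree

/-- Adds a multiple of a word. -/
def insert (w : ℕ) (c : ℤ) : WordTree → WordTree
  | leaf => node leaf w c leaf
  | node l v d r =>
      bif Nat.beq w v then node l v (d + c) r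
      else bif Nat.blt w v then node (insert w c l) v d r else node l v d (insert w c r)

/-- Tests whether all coefficients vanish. -/
def isZero : WordTree → Bool
  | leaf => true
  | node l _ c r => intIsZero c && (isZero l && isZero r)

end WordTree

/-- A sequence of generating transpositions whose partial products exhaust `S₃ × S₃`. -/
def groupPath : List ℕ :=
  [1, 2, 1, 2, 1, 5, 1, 2, 1, 2, 1, 6, 1, 2, 1, 2, 1, 5, 1, 2, 1, 2, 1, 6, 1, 2, 1, 2, 1, 5,
   1, 2, 1, 2, 1]

/-- Runs through the images of a word with coefficient `s`, replacing the candidate `c • b` by any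
image with a smaller code. -/
def canonWord : List ℕ → ℕ → ℕ → ℕ → ℤ → ℕ → ℤ → WordTree → WordTree
  | [], _, _, _, _, b, c, T => T.insert b c
  | p :: ps, i, j, k, s, b, c, T =>
      forced (fun i' => forced (fun j' => forced (fun k' =>
        forced (fun w =>
          (fun s' d => bif Nat.blt w b then canonWord ps i' j' k' s' w d T
            else bif Nat.beq w b then
              canonWord ps i' j' k' s' b (bif intIsZero (c - d) then c else 0) T
            else canonWord ps i' j' k' s' b c T) (-s) (bif Nat.blt i' j' then -s else s))
        (bif Nat.blt i' j' then wordCode i' j' k' else wordCode j' i' k'))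
        (digit (table p) k)) (digit (table p) j)) (digit (table p) i)

/-- Adds the normal form of a multiple of a word. -/
def addWord (c : ℤ) (i j k : ℕ) (T : WordTree) : WordTree :=
  bif Nat.beq i j then T
  else bif Nat.blt i j then canonWord groupPath i j k c (wordCode i j k) c T
  else canonWord groupPath j i k (-c) (wordCode j i k) (-c) T

/-- A formal combination of letters. -/
abbrev LetterComb : Type := List (ℤ × List ℕ)

/-- Replaces letters by their indices. -/
def toIndices (u : LetterComb) : List (ℤ × ℕ) :=
  u.map fun p => (p.1, letterIndex p.2)

/-- Adds the multiple `c` of the words in `u ⊗ v ⊗ w`. -/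
def addTensor (c : ℤ) (u v w : List (ℤ × ℕ)) (T : WordTree) : WordTree :=
  u.foldr (fun p T => v.foldr (fun q T => w.foldr (fun r T =>
    addWord (c * p.1 * q.1 * r.1) p.2 q.2 r.2 T) T) T) T

/-- The formal factorizations of `1 - R₃` and `R₃`. -/
def tripleRatioComb (a b c d e f g h : ℕ) : LetterComb × LetterComb :=
  ([(1, [a, b, c, d, e]), (1, [a, b, c, f, d, g, e, h]),
    (-1, [a, b, c, d, g]), (-1, [a, b, c, e, f]), (-1, [a, b, d, e, h])],
   [(1, [a, b, c, d, f]), (1, [a, b, c, e, h]), (1, [a, b, d, e, g]),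
    (-1, [a, b, c, d, g]), (-1, [a, b, c, e, f]), (-1, [a, b, d, e, h])])

/-- The formal factorizations of `1 - CR` and `CR`. -/
def crossRatioComb (a b c d e f g : ℕ) : LetterComb × LetterComb :=
  ([(1, [a, b, c, d, e]), (1, [a, b, c, f, g]), (-1, [a, b, c, d, g]), (-1, [a, b, c, e, f])],
   [(1, [a, b, c, d, f]), (1, [a, b, c, e, g]), (-1, [a, b, c, d, g]), (-1, [a, b, c, e, f])])

/-- The formal factorizations of `1 - x` and `x` for the cross-ratio
`x = ρ_{1,2} ρ_{3,4} / (ρ_{1,4} ρ_{3,2})`. -/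
def rhoComb : LetterComb × LetterComb :=
  ([(1, [3, 4, 1, 2, 5, 6, 9, 0]), (1, [4, 5, 2, 3, 6, 7, 9, 0]),
    (-1, [1, 2, 3, 4, 5, 6, 7, 9, 0]), (-1, [2, 3, 4, 5, 6]), (-1, [3, 4, 5, 9, 0])],
   [(1, [1, 2, 3, 4, 5]), (1, [2, 3, 4, 9, 0]), (1, [3, 4, 5, 6, 7]), (1, [4, 5, 6, 9, 0]),
    (-1, [1, 2, 3, 4, 5, 6, 7, 9, 0]), (-1, [2, 3, 4, 5, 6]), (-1, [3, 4, 5, 9, 0])])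

/-- The formal factorizations of `1 - x` and `x` for the terms of `Tcal`. -/
def combs : List (ℤ × LetterComb × LetterComb) :=
  [(3, rhoComb), (-3, tripleRatioComb 1 4 2 5 9 3 7 0), (-3, tripleRatioComb 5 4 1 7 9 2 6 0),
   (1, tripleRatioComb 1 4 2 5 7 3 6 9), (1, tripleRatioComb 1 4 2 5 9 3 7 6),
   (-1, tripleRatioComb 9 4 1 5 0 2 7 6), (-1, tripleRatioComb 9 4 1 5 7 2 6 0),
   (-1, crossRatioComb 1 5 4 2 7 6 9), (1, crossRatioComb 1 9 4 2 5 7 0)]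

/-- The normal form of the symbol. -/
def totalTree : WordTree :=
  combs.foldr (fun p T =>
    addTensor p.1 (toIndices p.2.2) (toIndices p.2.1) (toIndices p.2.2) T) WordTree.leaf

section Determinants

variable {N m : ℕ}

/-- The polynomial underlying `dets`. -/
noncomputable def detPoly (cols : Fin m → Fin N) : Pol N m :=
  (Matrix.of fun r c => (MvPolynomial.X (cols c, r) : Pol N m)).det

theorem dets_eq_algebraMap (cols : Fin m → Fin N) :
    dets N m cols = algebraMap (Pol N m) (FF N m) (detPoly cols) := by
  rw [dets, detPoly, RingHom.map_det]
  rfl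

theorem rename_detPoly (f : Fin N → Fin N) (cols : Fin m → Fin N) :
    MvPolynomial.rename (Prod.map f id) (detPoly cols) = detPoly (f ∘ cols) := by
  rw [detPoly, detPoly, AlgHom.map_det]
  congr 1
  ext r c
  simp

theorem detPoly_ne_zero {cols : Fin m → Fin N} (h : Function.Injective cols) :
    detPoly cols ≠ 0 := by
  intro h0
  have h1 := congrArg (MvPolynomial.aeval fun p : Fin N × Fin m =>
    if p.1 = cols p.2 then (1 : ℚ) else 0) h0
  rw [detPoly, AlgHom.map_det, map_zero] at h1
  refine one_ne_zero (α := ℚ) (Eq.trans ?_ h1)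
  rw [← Matrix.det_one (n := Fin m)]
  congr 1
  ext r c
  simp [Matrix.one_apply, h.eq_iff, eq_comm]

theorem detPoly_eq_zero {cols : Fin m → Fin N} (h : ¬ Function.Injective cols) :
    detPoly cols = 0 := by
  simp only [Function.Injective, not_forall] at h
  obtain ⟨i, j, hij, hne⟩ := h
  exact Matrix.det_zero_of_column_eq hne fun r => by simp [hij]

theorem dets_ne_zero {cols : Fin m → Fin N} (h : Function.Injective cols) :
    dets N m cols ≠ 0 := by
  rw [dets_eq_algebraMap]
  exact (map_ne_zero_iff _ (IsFractionRing.injective _ _)).mpr (detPoly_ne_zero h)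

/-- A difference of products of determinants does not vanish if after some identification of the
vectors only the first product survives. -/
theorem dets_mul_sub_dets_mul_ne_zero (f : Fin N → Fin N) {c₁ c₂ c₃ c₄ : Fin m → Fin N}
    (h₁ : Function.Injective (f ∘ c₁)) (h₂ : Function.Injective (f ∘ c₂))
    (h₃ : ¬ Function.Injective (f ∘ c₃)) :
    dets N m c₁ * dets N m c₂ - dets N m c₃ * dets N m c₄ ≠ 0 := by
  simp only [dets_eq_algebraMap, ← map_mul, ← map_sub]
  rw [map_ne_zero_iff _ (IsFractionRing.injective _ _)]
  intro h0
  have h := congrArg (MvPolynomial.rename (Prod.map f id)) h0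
  simp only [map_sub, map_mul, rename_detPoly, detPoly_eq_zero h₃, zero_mul, sub_zero, map_zero,
    mul_eq_zero, detPoly_ne_zero h₁, detPoly_ne_zero h₂, or_self] at h

theorem permAut_dets (σ : Equiv.Perm (Fin N)) (cols : Fin m → Fin N) :
    permAut N m σ (dets N m cols) = dets N m (σ ∘ cols) := by
  rw [dets_eq_algebraMap, dets_eq_algebraMap, permAut,
    IsFractionRing.ringEquivOfRingEquiv_algebraMap, ← rename_detPoly]
  rfl

theorem permAut_mul (σ τ : Equiv.Perm (Fin N)) (x : FF N m) :
    permAut N m (σ * τ) x = permAut N m σ (permAut N m τ x) := by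
  have h : (permAut N m (σ * τ) : FF N m →+* FF N m) =
      ((permAut N m σ : FF N m →+* FF N m)).comp (permAut N m τ : FF N m →+* FF N m) := by
    refine IsLocalization.ringHom_ext (nonZeroDivisors (Pol N m)) ?_
    ext x
    · simp [permAut]
    · simp [permAut, Prod.map]
  exact congrArg (fun g => g x) h

theorem dets_comp_swap {i j : Fin m} (hij : i ≠ j) (cols : Fin m → Fin N) :
    dets N m (cols ∘ Equiv.swap i j) = -dets N m cols := by
  have h := Matrix.det_permute' (Equiv.swap i j) (Matrix.of fun r c => gen N m (cols c) r)
  rw [Equiv.Perm.sign_swap hij] at h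
  simpa [dets, Matrix.submatrix] using h

/-- The three-term Plücker relation for the determinants of five vectors. -/
theorem det_plucker {R : Type*} [CommRing R] (a b c x y z w : Fin 5 → R) :
    (Matrix.of fun r k => ![a, b, c, x, y] k r).det *
        (Matrix.of fun r k => ![a, b, c, z, w] k r).det =
      (Matrix.of fun r k => ![a, b, c, w, y] k r).det *
          (Matrix.of fun r k => ![a, b, c, z, x] k r).det +
        (Matrix.of fun r k => ![a, b, c, x, w] k r).det *
          (Matrix.of fun r k => ![a, b, c, z, y] k r).det := by
  set A : Matrix (Fin 5) (Fin 5) R := Matrix.of fun r k => ![a, b, c, x, y] k r with hA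
  set B : Matrix (Fin 5) (Fin 5) R := Matrix.of fun r k => ![a, b, c, z, w] k r with hB
  have hB' (v : Fin 5 → R) :
      B.cramer v 4 = (Matrix.of fun r k => ![a, b, c, z, v] k r).det := by
    rw [Matrix.cramer_apply]
    congr 1
    ext r k
    fin_cases k <;> simp [hB]
  have h0 : B.cramer a 4 = 0 := by
    rw [hB']
    exact Matrix.det_zero_of_column_eq (i := 0) (j := 4) (by decide) fun r => rfl
  have h1 : B.cramer b 4 = 0 := by
    rw [hB']
    exact Matrix.det_zero_of_column_eq (i := 1) (j := 4) (by decide) fun r => rfl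
  have h2 : B.cramer c 4 = 0 := by
    rw [hB']
    exact Matrix.det_zero_of_column_eq (i := 2) (j := 4) (by decide) fun r => rfl
  have h3 : A.cramer w 3 = (Matrix.of fun r k => ![a, b, c, w, y] k r).det := by
    rw [Matrix.cramer_apply]
    congr 1
    ext r k
    fin_cases k <;> simp [hA]
  have h4 : A.cramer w 4 = (Matrix.of fun r k => ![a, b, c, x, w] k r).det := by
    rw [Matrix.cramer_apply]
    congr 1
    ext r k
    fin_cases k <;> simp [hA]
  have hw : A.det • w = A.cramer w 0 • a + A.cramer w 1 • b + A.cramer w 2 • c +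
      A.cramer w 3 • x + A.cramer w 4 • y := by
    rw [← A.mulVec_cramer w]
    ext r
    simp [Matrix.mulVec, dotProduct, Fin.sum_univ_five, hA, mul_comm]
  have h := congrArg (fun v => B.cramer v 4) hw
  simp only [map_add, map_smul, Pi.add_apply, Pi.smul_apply, smul_eq_mul, h0, h1, h2, h3, h4,
    mul_zero, zero_add] at h
  simpa only [hB'] using h

end Determinants

section Symbols

variable {F : Type} [Field F]

/-- The pure tensor `u ⊗ v ⊗ w`, built from the left. -/
def pure3 (u v w : VF F) : TP F 3 :=
  snoc (snoc (snoc (tprod ℚ (fun i : Fin 0 => i.elim0)) u) v) w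

theorem snoc_tprod {n : ℕ} (f : Fin n → VF F) (v : VF F) :
    snoc (tprod ℚ f) v = (tprod ℚ (Fin.snoc f v : Fin (n + 1) → VF F) : TP F (n + 1)) := by
  simp [snoc]

theorem pure3_eq_tprod (u v w : VF F) : pure3 u v w = tprod ℚ ![u, v, w] := by
  simp only [pure3, snoc_tprod]
  congr 1
  funext i
  fin_cases i <;> rfl

theorem splitLast_snoc {n : ℕ} (f : Fin n → VF F) (v : VF F) :
    splitLast n (snoc (tprod ℚ f) v) = (tprod ℚ f : TP F n) ⊗ₜ[ℚ] v := by
  rw [snoc_tprod]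
  have h0 (i : Fin n) : (Fin.snoc f v : Fin (n + 1) → VF F) (Fin.castAdd 1 i) = f i :=
    Fin.snoc_castSucc (α := fun _ => VF F) v f i
  have h1 : (Fin.snoc f v : Fin (n + 1) → VF F) (Fin.natAdd n 0) = v :=
    Fin.snoc_last (α := fun _ => VF F) v f
  simp [splitLast, h0, h1]

theorem cls_mul {a b : F} (ha : a ≠ 0) (hb : b ≠ 0) : cls (a * b) = cls a + cls b := by
  simp only [cls, ha, hb, mul_ne_zero, dif_neg, not_false_eq_true, ne_eq]
  rw [← TensorProduct.tmul_add, ← ofMul_mul]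
  congr 3
  ext; simp

theorem cls_one : cls (1 : F) = 0 := by
  have h := cls_mul (one_ne_zero (α := F)) one_ne_zero
  simpa using h

theorem cls_zero : cls (0 : F) = 0 := by simp [cls]

theorem cls_inv (a : F) : cls a⁻¹ = -cls a := by
  by_cases ha : a = 0
  · simp [ha, cls_zero]
  · have h := cls_mul ha (inv_ne_zero ha)
    rw [mul_inv_cancel₀ ha, cls_one] at h
    exact (neg_eq_of_add_eq_zero_right h.symm).symm

theorem cls_div {a b : F} (ha : a ≠ 0) (hb : b ≠ 0) : cls (a / b) = cls a - cls b := by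
  rw [div_eq_mul_inv, cls_mul ha (inv_ne_zero hb), cls_inv, sub_eq_add_neg]

theorem cls_neg (a : F) : cls (-a) = cls a := by
  by_cases ha : a = 0
  · simp [ha]
  · have h1 : (2 : ℚ) • cls (-1 : F) = 0 := by
      rw [two_smul, ← cls_mul (by simp) (by simp), neg_one_mul, neg_neg, cls_one]
    rw [← neg_one_mul, cls_mul (by simp) ha, (smul_eq_zero.mp h1).resolve_left two_ne_zero,
      zero_add]

theorem cls_map (φ : F ≃+* F) (a : F) : cls (φ a) = vmap φ (cls a) := by
  by_cases ha : a = 0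
  · simp [ha, cls_zero]
  · have hb : φ a ≠ 0 := by simpa using ha
    simp only [cls, ha, hb, dif_neg, not_false_eq_true, vmap]
    simp
    congr 2
    ext; simp

theorem SLi3_eq (x : F) : SLi3 x = -pure3 (cls (1 - x)) (cls x) (cls x) := by
  have h1 : (-x⁻¹ : F)⁻¹ = -x := by rw [inv_neg, inv_inv]
  by_cases hx : x = 0
  · subst hx
    simp [SLi3, SIaux, Fin.sum_univ_succ, tCoef, pure3, cls_one, cls_zero]
  by_cases hx1 : x = 1
  · subst hx1
    simp [SLi3, SIaux, Fin.sum_univ_succ, tCoef, pure3, cls_one, cls_zero]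
  have h2 : cls ((1 - x⁻¹) / -x⁻¹) = cls (1 - x) := by
    congr 1
    field_simp
    ring
  simp [SLi3, SIaux, Fin.sum_univ_succ, tCoef, pure3, cls_one, cls_inv, h2, hx, hx1, Ne.symm hx]

theorem rotN_tprod {n : ℕ} (f : Fin n → VF F) :
    rotN n (tprod ℚ f) = (tprod ℚ (fun i => f (finRotate n i)) : TP F n) := by
  simp [rotN]

theorem Pit_two (u v : VF F) :
    Pit 2 (tprod ℚ ![u, v]) = (tprod ℚ ![u, v] - tprod ℚ ![v, u] : TP F 2) := by
  have h : (tprod ℚ (fun i => ![u, v] (finRotate 2 i)) : TP F 2) = tprod ℚ ![v, u] := by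
    congr 1
    funext i
    fin_cases i <;> rfl
  simp only [Pit, TensorProduct.map_id, LinearMap.comp_apply, LinearMap.sub_apply,
    LinearMap.id_apply, LinearEquiv.coe_coe, rotN_tprod, h, LinearEquiv.symm_apply_apply]

theorem Pit_three (u v w : VF F) :
    Pit 3 (tprod ℚ ![u, v, w]) = pure3 u v w - pure3 v u w - (pure3 v w u - pure3 w v u) := by
  have h : (tprod ℚ (fun i => ![u, v, w] (finRotate 3 i)) : TP F 3) = tprod ℚ ![v, w, u] := by
    congr 1
    funext i
    fin_cases i <;> rfl
  have hs (a b c : VF F) : splitLast 2 (tprod ℚ ![a, b, c]) =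
      (tprod ℚ ![a, b] : TP F 2) ⊗ₜ[ℚ] c := by
    rw [← splitLast_snoc, snoc_tprod]
    congr 2
    funext i
    fin_cases i <;> rfl
  have hs' (a b c : VF F) : (splitLast 2).symm ((tprod ℚ ![a, b] : TP F 2) ⊗ₜ[ℚ] c) =
      pure3 a b c := by
    rw [← hs, LinearEquiv.symm_apply_apply, pure3_eq_tprod]
  have hP (a b c : VF F) : (splitLast 2).symm (TensorProduct.map (Pit 2) LinearMap.id
      (splitLast 2 (tprod ℚ ![a, b, c]))) = pure3 a b c - pure3 b a c := by
    rw [hs, TensorProduct.map_tmul, Pit_two, TensorProduct.sub_tmul, map_sub, LinearMap.id_apply,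
      hs', hs']
  rw [Pit]
  simp only [LinearMap.comp_apply, LinearMap.sub_apply, LinearMap.id_apply, LinearEquiv.coe_coe,
    rotN_tprod, h, map_sub, hP]

theorem Pit_pure3 (u v : VF F) : Pit 3 (pure3 u v v) = pure3 u v v - pure3 v u v := by
  rw [pure3_eq_tprod, Pit_three, sub_self, sub_zero, pure3_eq_tprod]

end Symbols

section Brackets

theorem d5_swap₀ (a b c d e : ℕ) : d5 b a c d e = -d5 a b c d e := by
  rw [d5, d5, ← dets_comp_swap (i := 0) (j := 1) (by decide)]
  congr 1
  funext k
  fin_cases k <;> rfl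

theorem d5_swap₁ (a b c d e : ℕ) : d5 a c b d e = -d5 a b c d e := by
  rw [d5, d5, ← dets_comp_swap (i := 1) (j := 2) (by decide)]
  congr 1
  funext k
  fin_cases k <;> rfl

theorem d5_swap₂ (a b c d e : ℕ) : d5 a b d c e = -d5 a b c d e := by
  rw [d5, d5, ← dets_comp_swap (i := 2) (j := 3) (by decide)]
  congr 1
  funext k
  fin_cases k <;> rfl

theorem d5_swap₃ (a b c d e : ℕ) : d5 a b c e d = -d5 a b c d e := by
  rw [d5, d5, ← dets_comp_swap (i := 3) (j := 4) (by decide)]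
  congr 1
  funext k
  fin_cases k <;> rfl

theorem d5_plucker (a b c x y z w : ℕ) :
    d5 a b c x y * d5 a b c z w =
      d5 a b c w y * d5 a b c z x + d5 a b c x w * d5 a b c z y := by
  have hd (p q r s t : ℕ) : d5 p q r s t = (Matrix.of fun i k =>
      ![gen 10 5 (L10 p), gen 10 5 (L10 q), gen 10 5 (L10 r), gen 10 5 (L10 s),
        gen 10 5 (L10 t)] k i).det := by
    rw [d5, dets]
    congr 1
    ext i k
    fin_cases k <;> rfl
  simp only [hd]
  exact det_plucker _ _ _ _ _ _ _

theorem injective_labels {a b c d e : Fin 10} :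
    Function.Injective ![a, b, c, d, e] ↔ [a, b, c, d, e].Nodup := by
  rw [← List.nodup_ofFn]
  simp

theorem d5_ne_zero {a b c d e : ℕ} (h : ([a, b, c, d, e].map L10).Nodup) : d5 a b c d e ≠ 0 :=
  dets_ne_zero (injective_labels.mpr h)

theorem permAut_d5 {σ : Equiv.Perm (Fin 10)} {s : ℕ → ℕ} {a b c d e : ℕ}
    (h : ∀ x ∈ [a, b, c, d, e], σ (L10 x) = L10 (s x)) :
    permAut 10 5 σ (d5 a b c d e) = d5 (s a) (s b) (s c) (s d) (s e) := by
  simp only [List.forall_mem_cons] at h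
  rw [d5, d5, permAut_dets]
  congr 1
  funext k
  fin_cases k <;> simp [h]

/-- Vanishes when, in the projection from `a, b`, the lines `c f`, `d g`, `e h` are concurrent. -/
noncomputable def concurrency (a b c f d g e h : ℕ) : K5 :=
  d5 a b c d g * d5 a b f e h - d5 a b f d g * d5 a b c e h

/-- The numerator of the difference of `⟨abcpx⟩ / ⟨abcpy⟩` and `⟨pdefx⟩ / ⟨pdefy⟩`. -/
noncomputable def ratioDiff (a b c p d e f x y : ℕ) : K5 :=
  d5 a b c p x * d5 p d e f y - d5 a b c p y * d5 p d e f x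

theorem comp_labels (f : Fin 10 → Fin 10) (a b c d e : Fin 10) :
    f ∘ ![a, b, c, d, e] = ![f a, f b, f c, f d, f e] := by
  funext k
  fin_cases k <;> rfl

theorem concurrency_ne_zero {a b c f d g e h : ℕ}
    (hl : ([a, b, c, f, d, g, e, h].map L10).Nodup) : concurrency a b c f d g e h ≠ 0 := by
  rw [concurrency, mul_comm (d5 a b f d g)]
  simp only [List.map_cons, List.map_nil, List.nodup_cons, List.mem_cons, List.not_mem_nil,
    or_false, not_or, List.nodup_nil, not_false_eq_true, and_true] at hl
  refine dets_mul_sub_dets_mul_ne_zero (fun x => if x = L10 e then L10 c else x) ?_ ?_ ?_ <;>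
    rw [comp_labels, injective_labels] <;> grind

theorem ratioDiff_ne_zero {a b c p d e f x y : ℕ}
    (hl : ([a, b, c, p, d, e, f, x, y].map L10).Nodup) : ratioDiff a b c p d e f x y ≠ 0 := by
  simp only [List.map_cons, List.map_nil, List.nodup_cons, List.mem_cons, List.not_mem_nil,
    or_false, not_or, List.nodup_nil, not_false_eq_true, and_true] at hl
  refine dets_mul_sub_dets_mul_ne_zero (fun z => if z = L10 y then L10 a else z) ?_ ?_ ?_ <;>
    rw [comp_labels, injective_labels] <;> grind

end Brackets

theorem exists_eq_five {α : Type*} {l : List α} (hl : l.length = 5) :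
    ∃ a b c d e, l = [a, b, c, d, e] :=
  match l, hl with
  | [a, b, c, d, e], _ => ⟨a, b, c, d, e, rfl⟩

theorem exists_eq_eight {α : Type*} {l : List α} (hl : l.length = 8) :
    ∃ a b c d e f g h, l = [a, b, c, d, e, f, g, h] :=
  match l, hl with
  | [a, b, c, d, e, f, g, h], _ => ⟨a, b, c, d, e, f, g, h, rfl⟩

theorem exists_eq_nine {α : Type*} {l : List α} (hl : l.length = 9) :
    ∃ a b c d e f g h i, l = [a, b, c, d, e, f, g, h, i] :=
  match l, hl with
  | [a, b, c, d, e, f, g, h, i], _ => ⟨a, b, c, d, e, f, g, h, i, rfl⟩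

/-- The class in `V_F` of the letter named by a list of labels. -/
noncomputable def letterClass : List ℕ → VF K5
  | [a, b, c, d, e] => cls (d5 a b c d e)
  | [a, b, c, f, d, g, e, h] => cls (concurrency a b c f d g e h)
  | [a, b, c, p, d, e, f, x, y] => cls (ratioDiff a b c p d e f x y)
  | _ => 0

theorem vmap_letterClass {σ : Equiv.Perm (Fin 10)} {s : ℕ → ℕ} {l : List ℕ}
    (h : ∀ x ∈ l, σ (L10 x) = L10 (s x)) :
    vmap (permAut 10 5 σ) (letterClass l) = letterClass (l.map s) := by
  unfold letterClass
  split
  · rw [← cls_map, permAut_d5 h]; rfl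
  · simp only [List.forall_mem_cons] at h
    rw [← cls_map, concurrency, map_sub, map_mul, map_mul]
    repeat rw [permAut_d5 (s := s) (by simp [h])]
    rfl
  · simp only [List.forall_mem_cons] at h
    rw [← cls_map, ratioDiff, map_sub, map_mul, map_mul]
    repeat rw [permAut_d5 (s := s) (by simp [h])]
    rfl
  · rename_i h₁ h₂ h₃
    rw [map_zero]
    split
    · rename_i hm
      obtain ⟨a, b, c, d, e, rfl⟩ := exists_eq_five (by simpa using congrArg List.length hm)
      exact (h₁ _ _ _ _ _ rfl).elim
    · rename_i hm
      obtain ⟨a, b, c, f, d, g, e, h', rfl⟩ :=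
        exists_eq_eight (by simpa using congrArg List.length hm)
      exact (h₂ _ _ _ _ _ _ _ _ rfl).elim
    · rename_i hm
      obtain ⟨a, b, c, p, d, e, f, x, y, rfl⟩ :=
        exists_eq_nine (by simpa using congrArg List.length hm)
      exact (h₃ _ _ _ _ _ _ _ _ _ rfl).elim
    · rfl

theorem letterClass_exch {k : ℕ} {l : List ℕ} (h : k ∈ sortingNetwork l.length) :
    letterClass (exch k l) = letterClass l := by
  unfold sortingNetwork at h
  split at h
  · rename_i hl
    obtain ⟨a, b, c, d, e, rfl⟩ := exists_eq_five hl
    have hk : k = 0 ∨ k = 1 ∨ k = 2 ∨ k = 3 := by simp at h; omega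
    rcases hk with rfl | rfl | rfl | rfl <;>
    [cases hc : Nat.blt b a; cases hc : Nat.blt c b; cases hc : Nat.blt d c;
      cases hc : Nat.blt e d] <;>
    simp only [exch, hc, cond_true, cond_false, letterClass, d5_swap₀ a, d5_swap₁ a b,
      d5_swap₂ a b c, d5_swap₃ a b c d, cls_neg]
  · rename_i hl
    obtain ⟨a, b, c, f, d, g, e, h', rfl⟩ := exists_eq_eight hl
    have hk : k = 0 ∨ k = 2 ∨ k = 4 ∨ k = 6 := by simp at h; omega
    rcases hk with rfl | rfl | rfl | rfl
    · cases hc : Nat.blt b a <;> simp only [exch, hc, cond_true, cond_false, letterClass]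
      simp only [concurrency, d5_swap₀ a b, neg_mul_neg]
    · cases hc : Nat.blt f c <;> simp only [exch, hc, cond_true, cond_false, letterClass]
      rw [← cls_neg, concurrency, concurrency, neg_sub]
    · cases hc : Nat.blt g d <;> simp only [exch, hc, cond_true, cond_false, letterClass]
      rw [← cls_neg]
      simp only [concurrency, d5_swap₃ a b _ d g]
      congr 1
      ring
    · cases hc : Nat.blt h' e <;> simp only [exch, hc, cond_true, cond_false, letterClass]
      rw [← cls_neg]
      simp only [concurrency, d5_swap₃ a b _ e h']
      congr 1
      ring
  · rename_i hl
    obtain ⟨a, b, c, p, d, e, f, x, y, rfl⟩ := exists_eq_nine hl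
    have hk : k = 0 ∨ k = 1 ∨ k = 4 ∨ k = 5 := by simp at h; omega
    rcases hk with rfl | rfl | rfl | rfl <;>
    [cases hc : Nat.blt b a; cases hc : Nat.blt c b; cases hc : Nat.blt e d;
      cases hc : Nat.blt f e] <;>
    simp only [exch, hc, cond_true, cond_false, letterClass]
    all_goals
      rw [← cls_neg]
      simp only [ratioDiff, d5_swap₀ a b, d5_swap₁ a b c, d5_swap₁ p d e, d5_swap₂ p d e f]
      congr 1
      ring
  · simp at h

theorem length_exch (k : ℕ) (l : List ℕ) : (exch k l).length = l.length := by
  fun_induction exch k l with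
  | case3 k x l ih => simp [ih]
  | _ => simp_all

theorem letterClass_canonLetter (l : List ℕ) : letterClass (canonLetter l) = letterClass l := by
  have key (ks : List ℕ) : ∀ m : List ℕ, (∀ k ∈ ks, k ∈ sortingNetwork m.length) →
      letterClass (ks.foldl (fun m k => exch k m) m) = letterClass m := by
    induction ks with
    | nil => exact fun _ _ => rfl
    | cons k ks ih =>
      intro m hm
      rw [List.forall_mem_cons] at hm
      rw [List.foldl_cons, ih _ (by simpa only [length_exch] using hm.2), letterClass_exch hm.1]
  exact key _ l fun _ h => h

section Brackets

theorem d5_swap_pairs (a b c d e : ℕ) : d5 c d a b e = d5 a b c d e := by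
  rw [d5_swap₁ c a d, d5_swap₀ a c, d5_swap₂ a c b d, d5_swap₁ a b c, neg_neg, neg_neg]

theorem d5_rotate (a b x y z : ℕ) : d5 a b y z x = d5 a b x y z := by
  rw [d5_swap₃ a b y x z, d5_swap₂ a b x y, neg_neg]

theorem tripleRatio_identity (a b c d e f g h : ℕ) :
    d5 a b c d g * d5 a b c e f * d5 a b d e h - d5 a b c d f * d5 a b c e h * d5 a b d e g =
      -(d5 a b c d e * concurrency a b c f d g e h) := by
  have p₁ := d5_plucker a b e c d f h
  have p₂ := d5_plucker a b d c e f g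
  rw [← d5_rotate a b e c d, d5_swap₂ a b f e h, d5_rotate a b d e h, d5_rotate a b c e f,
    d5_swap₂ a b c e h, d5_rotate a b d e f] at p₁
  rw [d5_swap₂ a b c d e, d5_swap₂ a b f d g, d5_swap₃ a b d e g, d5_rotate a b c d f,
    d5_swap₂ a b c d g, d5_swap₃ a b d e f] at p₂
  rw [concurrency]
  linear_combination -d5 a b c d g * p₁ - d5 a b c e h * p₂

theorem concurrency_eq {a b c f d : ℕ} (hl : ([a, b, c, f, d].map L10).Nodup) (g e h : ℕ) :
    concurrency a b c f d g e h =
      d5 a b c f e * d5 a b d g h - d5 a b c f h * d5 a b d g e := by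
  have p₁ := d5_plucker a b f c d e h
  have p₂ := d5_plucker a b c f d e h
  have p₃ := d5_plucker a b d c f g h
  have p₄ := d5_plucker a b d c f g e
  refine mul_left_cancel₀ (d5_ne_zero hl) ?_
  rw [d5_swap₂ a b c f d, d5_swap₃ a b f d h, d5_rotate a b c f e, d5_swap₂ a b c f h,
    d5_swap₃ a b f d e] at p₁
  rw [d5_swap₃ a b c d h, d5_swap₃ a b c f e, d5_swap₃ a b c d e] at p₂
  rw [← d5_rotate a b d c f, d5_rotate a b f d h, d5_rotate a b c d g, d5_swap₂ a b c d h,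
    d5_rotate a b f d g] at p₃
  rw [← d5_rotate a b d c f, d5_rotate a b f d e, d5_rotate a b c d g, d5_swap₂ a b c d e,
    d5_rotate a b f d g] at p₄
  rw [concurrency]
  linear_combination -d5 a b c d g * p₁ - d5 a b f d g * p₂ - d5 a b c f e * p₃ + d5 a b c f h * p₄

end Brackets

/-- The value of a formal combination of letters. -/
noncomputable def LetterComb.eval (u : LetterComb) : VF K5 :=
  (u.map fun p => (p.1 : ℚ) • letterClass p.2).sum

theorem cls_R3 {a b c d e f g h : ℕ} (hl : ([a, b, c, d, e, f, g, h].map L10).Nodup) :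
    cls (1 - R3 a b c d e f g h) = (tripleRatioComb a b c d e f g h).1.eval ∧
      cls (R3 a b c d e f g h) = (tripleRatioComb a b c d e f g h).2.eval := by
  have h₀ : concurrency a b c f d g e h ≠ 0 := concurrency_ne_zero (by simp_all; grind)
  have h₁ : d5 a b c d e ≠ 0 := d5_ne_zero (by simp_all)
  have h₂ : d5 a b c d g ≠ 0 := d5_ne_zero (by simp_all)
  have h₃ : d5 a b c e f ≠ 0 := d5_ne_zero (by simp_all)
  have h₄ : d5 a b d e h ≠ 0 := d5_ne_zero (by simp_all)
  have h₅ : d5 a b c d f ≠ 0 := d5_ne_zero (by simp_all)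
  have h₆ : d5 a b c e h ≠ 0 := d5_ne_zero (by simp_all)
  have h₇ : d5 a b d e g ≠ 0 := d5_ne_zero (by simp_all)
  have hD := mul_ne_zero (mul_ne_zero h₂ h₃) h₄
  rw [R3, one_sub_div hD, tripleRatio_identity, cls_div (neg_ne_zero.mpr (mul_ne_zero h₁ h₀)) hD,
    cls_neg, cls_div (mul_ne_zero (mul_ne_zero h₅ h₆) h₇) hD]
  simp only [cls_mul, mul_ne_zero, ne_eq, not_false_eq_true, h₀, h₁, h₂, h₃, h₄, h₅, h₆, h₇]
  constructor <;>
  · simp [LetterComb.eval, tripleRatioComb, letterClass]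
    abel

theorem cls_CR5 {a b c d e f g : ℕ} (hl : ([a, b, c, d, e, f, g].map L10).Nodup) :
    cls (1 - CR5 a b c d e f g) = (crossRatioComb a b c d e f g).1.eval ∧
      cls (CR5 a b c d e f g) = (crossRatioComb a b c d e f g).2.eval := by
  have h₁ : d5 a b c d e ≠ 0 := d5_ne_zero (by simp_all)
  have h₂ : d5 a b c f g ≠ 0 := d5_ne_zero (by simp_all)
  have h₃ : d5 a b c d g ≠ 0 := d5_ne_zero (by simp_all)
  have h₄ : d5 a b c e f ≠ 0 := d5_ne_zero (by simp_all)
  have h₅ : d5 a b c d f ≠ 0 := d5_ne_zero (by simp_all)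
  have h₆ : d5 a b c e g ≠ 0 := d5_ne_zero (by simp_all)
  have hD := mul_ne_zero h₃ h₄
  have hp : d5 a b c d g * d5 a b c e f - d5 a b c d f * d5 a b c e g =
      -(d5 a b c d e * d5 a b c f g) := by
    have p := d5_plucker a b c d e f g
    rw [d5_swap₃ a b c e g, d5_swap₃ a b c d f, d5_swap₃ a b c e f] at p
    linear_combination p
  rw [CR5, one_sub_div hD, hp, cls_div (neg_ne_zero.mpr (mul_ne_zero h₁ h₂)) hD,
    cls_neg, cls_div (mul_ne_zero h₅ h₆) hD]
  simp only [cls_mul, ne_eq, not_false_eq_true, h₁, h₂, h₃, h₄, h₅, h₆]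
  constructor <;>
  · simp [LetterComb.eval, crossRatioComb, letterClass]
    abel

theorem rr5_eq {i j : ℕ} {x y z w p q : K5} (hi : rho5 i = x / p) (hj : rho5 j = y / q)
    (hp : p ≠ 0) (hq : q ≠ 0) (h : x * q - p * y = z * w) : rr5 i j = z * w / (p * q) := by
  rw [rr5, hi, hj, div_sub_div _ _ hp hq, h]

theorem cls_crossRatio_rho :
    cls (1 - rr5 1 2 * rr5 3 4 / (rr5 1 4 * rr5 3 2)) = rhoComb.1.eval ∧
      cls (rr5 1 2 * rr5 3 4 / (rr5 1 4 * rr5 3 2)) = rhoComb.2.eval := by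
  have q₁ : d5 1 2 3 4 0 ≠ 0 := d5_ne_zero (by decide)
  have q₂ : d5 2 3 4 5 0 ≠ 0 := d5_ne_zero (by decide)
  have q₃ : d5 3 4 5 6 0 ≠ 0 := d5_ne_zero (by decide)
  have q₄ : d5 4 5 6 7 0 ≠ 0 := d5_ne_zero (by decide)
  have h₁ : d5 1 2 3 4 5 ≠ 0 := d5_ne_zero (by decide)
  have h₂ : d5 2 3 4 9 0 ≠ 0 := d5_ne_zero (by decide)
  have h₃ : d5 3 4 5 6 7 ≠ 0 := d5_ne_zero (by decide)
  have h₄ : d5 4 5 6 9 0 ≠ 0 := d5_ne_zero (by decide)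
  have h₅ : d5 2 3 4 5 6 ≠ 0 := d5_ne_zero (by decide)
  have h₆ : d5 3 4 5 9 0 ≠ 0 := d5_ne_zero (by decide)
  have h₇ : ratioDiff 1 2 3 4 5 6 7 9 0 ≠ 0 := ratioDiff_ne_zero (by decide)
  have h₈ : concurrency 3 4 1 2 5 6 9 0 ≠ 0 := concurrency_ne_zero (by decide)
  have h₉ : concurrency 4 5 2 3 6 7 9 0 ≠ 0 := concurrency_ne_zero (by decide)
  have e₁ : rho5 1 = d5 1 2 3 4 9 / d5 1 2 3 4 0 := rfl
  have e₂ : rho5 2 = d5 2 3 4 5 9 / d5 2 3 4 5 0 := rfl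
  have e₃ : rho5 3 = d5 3 4 5 6 9 / d5 3 4 5 6 0 := rfl
  have e₄ : rho5 4 = d5 4 5 6 7 9 / d5 4 5 6 7 0 := rfl
  have adj (a b c p q : ℕ) : d5 p a b c 9 * d5 a b c q 0 - d5 p a b c 0 * d5 a b c q 9 =
      d5 p a b c q * d5 a b c 9 0 := by
    have hr (x : ℕ) : d5 p a b c x = -d5 a b c p x := by
      rw [d5_swap₀ a p, d5_swap₁ a b p, d5_swap₂ a b c p, neg_neg]
    rw [hr, hr, hr]
    have h := d5_plucker a b c p q 9 0
    rw [d5_swap₃ a b c q 0, d5_swap₃ a b c p 9, d5_swap₃ a b c q 9] at h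
    linear_combination h
  have r₁₂ := rr5_eq e₁ e₂ q₁ q₂ (adj 2 3 4 1 5)
  have r₃₄ := rr5_eq e₃ e₄ q₃ q₄ (adj 4 5 6 3 7)
  have r₂₃ := rr5_eq e₂ e₃ q₂ q₃ (adj 3 4 5 2 6)
  have r₃₂ : rr5 3 2 = -rr5 2 3 := by rw [rr5, rr5, neg_sub]
  have r₁₄ : rr5 1 4 = ratioDiff 1 2 3 4 5 6 7 9 0 / (d5 1 2 3 4 0 * d5 4 5 6 7 0) := by
    rw [rr5, e₁, e₄, div_sub_div _ _ q₁ q₄]; rfl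
  have r₁₃ : rr5 1 3 = concurrency 3 4 1 2 5 6 9 0 / (d5 1 2 3 4 0 * d5 3 4 5 6 0) := by
    rw [rr5, e₁, e₃, div_sub_div _ _ q₁ q₃, concurrency_eq (by decide), ← d5_swap_pairs 1 2 3 4 9,
      ← d5_swap_pairs 1 2 3 4 0]
  have r₂₄ : rr5 2 4 = concurrency 4 5 2 3 6 7 9 0 / (d5 2 3 4 5 0 * d5 4 5 6 7 0) := by
    rw [rr5, e₂, e₄, div_sub_div _ _ q₂ q₄, concurrency_eq (by decide), ← d5_swap_pairs 2 3 4 5 9,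
      ← d5_swap_pairs 2 3 4 5 0]
  have n₁₄ : rr5 1 4 ≠ 0 := r₁₄ ▸ div_ne_zero h₇ (mul_ne_zero q₁ q₄)
  have n₃₂ : rr5 3 2 ≠ 0 := r₃₂ ▸ neg_ne_zero.mpr
    (r₂₃ ▸ div_ne_zero (mul_ne_zero h₅ h₆) (mul_ne_zero q₂ q₃))
  have h : 1 - rr5 1 2 * rr5 3 4 / (rr5 1 4 * rr5 3 2) =
      -(rr5 1 3 * rr5 2 4) / (rr5 1 4 * rr5 3 2) := by
    rw [one_sub_div (mul_ne_zero n₁₄ n₃₂)]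
    congr 1
    simp only [rr5]
    ring
  have k₁ : 1 - rr5 1 2 * rr5 3 4 / (rr5 1 4 * rr5 3 2) =
      concurrency 3 4 1 2 5 6 9 0 * concurrency 4 5 2 3 6 7 9 0 /
        (ratioDiff 1 2 3 4 5 6 7 9 0 * (d5 2 3 4 5 6 * d5 3 4 5 9 0)) := by
    rw [h, r₁₃, r₂₄, r₁₄, r₃₂, r₂₃]
    field_simp
  have k₂ : rr5 1 2 * rr5 3 4 / (rr5 1 4 * rr5 3 2) =
      -(d5 1 2 3 4 5 * d5 2 3 4 9 0 * (d5 3 4 5 6 7 * d5 4 5 6 9 0) /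
        (ratioDiff 1 2 3 4 5 6 7 9 0 * (d5 2 3 4 5 6 * d5 3 4 5 9 0))) := by
    rw [r₁₂, r₃₄, r₁₄, r₃₂, r₂₃]
    field_simp
  have hD := mul_ne_zero h₇ (mul_ne_zero h₅ h₆)
  have hN := mul_ne_zero (mul_ne_zero h₁ h₂) (mul_ne_zero h₃ h₄)
  rw [k₁, k₂, cls_neg, cls_div (mul_ne_zero h₈ h₉) hD, cls_div hN hD]
  simp only [cls_mul, mul_ne_zero, ne_eq, not_false_eq_true, h₁, h₂, h₃, h₄, h₅, h₆, h₇, h₈, h₉]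
  constructor <;>
  · simp [LetterComb.eval, rhoComb, letterClass]
    abel

theorem Tcal_combs : List.Forall₂ (fun p q =>
    p.1 = (q.1 : ℚ) ∧ cls (1 - p.2) = q.2.1.eval ∧ cls p.2 = q.2.2.eval) Tcal combs := by
  have h₁ := cls_crossRatio_rho
  have h₂ := @cls_R3 1 4 2 5 9 3 7 0 (by decide)
  have h₃ := @cls_R3 5 4 1 7 9 2 6 0 (by decide)
  have h₄ := @cls_R3 1 4 2 5 7 3 6 9 (by decide)
  have h₅ := @cls_R3 1 4 2 5 9 3 7 6 (by decide)
  have h₆ := @cls_R3 9 4 1 5 0 2 7 6 (by decide)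
  have h₇ := @cls_R3 9 4 1 5 7 2 6 0 (by decide)
  have h₈ := @cls_CR5 1 5 4 2 7 6 9 (by decide)
  have h₉ := @cls_CR5 1 9 4 2 5 7 0 (by decide)
  simp only [Tcal, combs, List.forall₂_cons, List.forall₂_nil_left_iff, and_true]
  exact ⟨⟨by norm_num, h₁⟩, ⟨by norm_num, h₂⟩, ⟨by norm_num, h₃⟩, ⟨by norm_num, h₄⟩,
    ⟨by norm_num, h₅⟩, ⟨by norm_num, h₆⟩, ⟨by norm_num, h₇⟩, ⟨by norm_num, h₈⟩,
    ⟨by norm_num, h₉⟩⟩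

/-- The pure tensor `u ⊗ v ⊗ w` as a trilinear map. -/
noncomputable def pureTensor : VF K5 →ₗ[ℚ] VF K5 →ₗ[ℚ] VF K5 →ₗ[ℚ] TP K5 3 :=
  (snoc ∘ₗ snoc (tprod ℚ fun i : Fin 0 => i.elim0)).compr₂ snoc

/-- The skew-symmetrization of `u ⊗ v ⊗ w - v ⊗ u ⊗ w` over `S_{{1,2,3}} × S_{{5,6,7}}`. -/
noncomputable def altTensor : VF K5 →ₗ[ℚ] VF K5 →ₗ[ℚ] VF K5 →ₗ[ℚ] TP K5 3 :=
  ∑ σ ∈ Finset.univ.filter fixSets, (((Equiv.Perm.sign σ : ℤˣ) : ℤ) : ℚ) •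
    ((pureTensor + (-1 : ℚ) • pureTensor.flip).compl₁₂ (vmap (permAut 10 5 σ)) (vmap (permAut 10 5 σ))).compr₂
      (LinearMap.lcomp ℚ _ (vmap (permAut 10 5 σ)))

theorem altTensor_apply (u v w : VF K5) : altTensor u v w =
    ∑ σ ∈ Finset.univ.filter fixSets, (((Equiv.Perm.sign σ : ℤˣ) : ℤ) : ℚ) •
      (pure3 (vmap (permAut 10 5 σ) u) (vmap (permAut 10 5 σ) v) (vmap (permAut 10 5 σ) w) -
        pure3 (vmap (permAut 10 5 σ) v) (vmap (permAut 10 5 σ) u) (vmap (permAut 10 5 σ) w)) := by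
  simp only [altTensor, LinearMap.sum_apply, LinearMap.smul_apply]
  refine Finset.sum_congr rfl fun σ _ => ?_
  congr 1

theorem altTensor_swap (u v w : VF K5) : altTensor v u w = -altTensor u v w := by
  rw [altTensor_apply, altTensor_apply, ← Finset.sum_neg_distrib]
  refine Finset.sum_congr rfl fun σ _ => ?_
  rw [← smul_neg, neg_sub]

theorem fixSets_mul {σ τ : Equiv.Perm (Fin 10)} (hσ : fixSets σ) (hτ : fixSets τ) :
    fixSets (σ * τ) := by
  refine ⟨fun i hi => hσ.1 _ (hτ.1 i hi), fun i h₁ h₂ => ?_, fun i h₁ h₂ => ?_⟩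
  · have h := hτ.2.1 i h₁ h₂
    exact hσ.2.1 _ h.1 h.2
  · rw [Equiv.Perm.mul_apply, hτ.2.2 i h₁ h₂, hσ.2.2 i h₁ h₂]

theorem vmap_permAut_mul (σ τ : Equiv.Perm (Fin 10)) (u : VF K5) :
    vmap (permAut 10 5 (σ * τ)) u = vmap (permAut 10 5 σ) (vmap (permAut 10 5 τ) u) := by
  induction u using TensorProduct.induction_on with
  | zero => simp only [map_zero]
  | add u v hu hv => simp only [map_add, hu, hv]
  | tmul r a =>
    have h : (vmap (permAut 10 5 (σ * τ))) (r ⊗ₜ[ℤ] a) = r ⊗ₜ[ℤ] _ := rfl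
    rw [h]
    congr 1
    refine congrArg Additive.ofMul (Units.ext ?_)
    exact permAut_mul σ τ _

theorem altTensor_vmap_swap {i j : Fin 10} (hij : i ≠ j) (h : fixSets (Equiv.swap i j))
    (u v w : VF K5) :
    altTensor (vmap (permAut 10 5 (Equiv.swap i j)) u) (vmap (permAut 10 5 (Equiv.swap i j)) v)
      (vmap (permAut 10 5 (Equiv.swap i j)) w) = -altTensor u v w := by
  rw [altTensor_apply, altTensor_apply, ← Finset.sum_neg_distrib]
  refine Finset.sum_equiv (Equiv.mulRight (Equiv.swap i j)) (fun σ => ?_) (fun σ _ => ?_)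
  · simp only [Finset.mem_filter, Finset.mem_univ, true_and, Equiv.coe_mulRight]
    refine ⟨fun hσ => fixSets_mul hσ h, fun hσ => ?_⟩
    simpa [mul_assoc] using fixSets_mul hσ h
  · simp only [Equiv.coe_mulRight, vmap_permAut_mul, Equiv.Perm.sign_mul,
      Equiv.Perm.sign_swap hij]
    simp

theorem forced_eq {α : Type} (f : ℕ → α) (n : ℕ) : forced f n = f n := by
  cases n <;> rfl

theorem digit_lt (t i : ℕ) : digit t i < 128 := Nat.mod_lt _ (by norm_num)

theorem digit_wordCode {i j k : ℕ} (hi : i < 128) (hj : j < 128) (hk : k < 128) :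
    digit (wordCode i j k) 0 = i ∧ digit (wordCode i j k) 1 = j ∧
      digit (wordCode i j k) 2 = k := by
  change (i + 128 * (j + 128 * k)) / 1 % 128 = i ∧ (i + 128 * (j + 128 * k)) / 128 % 128 = j ∧
    (i + 128 * (j + 128 * k)) / 16384 % 128 = k
  omega

theorem intIsZero_iff {n : ℤ} : intIsZero n = true ↔ n = 0 := by
  cases n <;> simp [intIsZero]

/-- The value of the word with a given code. -/
def wordValue {M : Type} (φ : ℕ → ℕ → ℕ → M) (w : ℕ) : M := φ (digit w 0) (digit w 1) (digit w 2)

theorem wordValue_wordCode {M : Type} (φ : ℕ → ℕ → ℕ → M) {i j k : ℕ} (hi : i < 128) (hj : j < 128)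
    (hk : k < 128) : wordValue φ (wordCode i j k) = φ i j k := by
  obtain ⟨h₀, h₁, h₂⟩ := digit_wordCode hi hj hk
  rw [wordValue, h₀, h₁, h₂]

section Evaluation

variable {M : Type} [AddCommGroup M] [Module ℚ M]

/-- The value of a tree of words. -/
def WordTree.eval (ψ : ℕ → M) : WordTree → M
  | leaf => 0
  | node l w c r => eval ψ l + (c : ℚ) • ψ w + eval ψ r

theorem WordTree.eval_insert (ψ : ℕ → M) (w : ℕ) (c : ℤ) (T : WordTree) :
    (T.insert w c).eval ψ = T.eval ψ + (c : ℚ) • ψ w := by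
  induction T with
  | leaf => simp [insert, eval]
  | node l v d r hl hr =>
    rw [insert]
    cases h : Nat.beq w v
    · cases h' : Nat.blt w v <;> simp only [cond_true, cond_false, eval, hl, hr] <;> abel
    · obtain rfl := Nat.eq_of_beq_eq_true h
      simp only [cond_true, eval, Int.cast_add, add_smul]
      abel

theorem WordTree.eval_eq_zero (ψ : ℕ → M) {T : WordTree} (h : T.isZero = true) :
    T.eval ψ = 0 := by
  induction T with
  | leaf => rfl
  | node l v d r hl hr =>
    simp only [isZero, Bool.and_eq_true, intIsZero_iff] at h
    simp [eval, h.1, hl h.2.1, hr h.2.2]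

/-- Functions of words which are skew in the first two letters and change sign under the
generating transpositions. -/
structure IsSkew (φ : ℕ → ℕ → ℕ → M) : Prop where
  swap : ∀ i j k, φ j i k = -φ i j k
  transposition : ∀ p ∈ groupPath, ∀ i j k,
    φ (digit (table p) i) (digit (table p) j) (digit (table p) k) = -φ i j k

variable {φ : ℕ → ℕ → ℕ → M}

theorem IsSkew.eval_canonWord (hφ : IsSkew φ) {X : M} (ps : List ℕ) :
    ∀ {i j k : ℕ} {s : ℤ} {b : ℕ} {c : ℤ} {T : WordTree}, ps ⊆ groupPath →
      (s : ℚ) • φ i j k = X → (c : ℚ) • wordValue φ b = X →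
      (canonWord ps i j k s b c T).eval (wordValue φ) = T.eval (wordValue φ) + X := by
  induction ps with
  | nil =>
    intro i j k s b c T _ _ hc
    rw [canonWord, WordTree.eval_insert, hc]
  | cons p ps ih =>
    intro i j k s b c T hp hs hc
    rw [List.cons_subset] at hp
    have key {w : ℕ} {d : ℤ} {i' j' k' : ℕ} (hs' : ((-s : ℤ) : ℚ) • φ i' j' k' = X)
        (hd : (d : ℚ) • wordValue φ w = X) :
        (bif Nat.blt w b then canonWord ps i' j' k' (-s) w d T
          else bif Nat.beq w b then
            canonWord ps i' j' k' (-s) b (bif intIsZero (c - d) then c else 0) T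
          else canonWord ps i' j' k' (-s) b c T).eval (wordValue φ) =
            T.eval (wordValue φ) + X := by
      cases Nat.blt w b
      · cases h : Nat.beq w b
        · exact ih hp.2 hs' hc
        · refine ih hp.2 hs' ?_
          cases hz : intIsZero (c - d)
          · obtain rfl := Nat.eq_of_beq_eq_true h
            have hne : ((c - d : ℤ) : ℚ) ≠ 0 := by
              rw [Int.cast_ne_zero]
              intro h0
              simp [intIsZero_iff.mpr h0] at hz
            have h0 : ((c - d : ℤ) : ℚ) • wordValue φ w = 0 := by
              rw [Int.cast_sub, sub_smul, hc, hd, sub_self]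
            rw [(smul_eq_zero.mp h0).resolve_left hne, smul_zero] at hc
            simp [← hc]
          · exact hc
      · exact ih hp.2 hs' hd
    simp only [canonWord, forced_eq]
    have ht := hφ.transposition p hp.1 i j k
    have hs' : ((-s : ℤ) : ℚ) •
        φ (digit (table p) i) (digit (table p) j) (digit (table p) k) = X := by
      rw [ht, Int.cast_neg, neg_smul, smul_neg, neg_neg, hs]
    refine key hs' ?_
    cases Nat.blt (digit (table p) i) (digit (table p) j)
    · rw [cond_false, cond_false, wordValue_wordCode _ (digit_lt _ _) (digit_lt _ _) (digit_lt _ _),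
        hφ.swap, ht, neg_neg, hs]
    · rwa [cond_true, cond_true, wordValue_wordCode _ (digit_lt _ _) (digit_lt _ _) (digit_lt _ _)]

theorem IsSkew.eval_addWord (hφ : IsSkew φ) (c : ℤ) {i j k : ℕ} (hi : i < 128) (hj : j < 128)
    (hk : k < 128) (T : WordTree) :
    (addWord c i j k T).eval (wordValue φ) = T.eval (wordValue φ) + (c : ℚ) • φ i j k := by
  rw [addWord]
  cases h : Nat.beq i j
  · cases Nat.blt i j
    · have hc : ((-c : ℤ) : ℚ) • φ j i k = (c : ℚ) • φ i j k := by
        rw [hφ.swap i j k, Int.cast_neg, neg_smul, smul_neg, neg_neg]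
      refine hφ.eval_canonWord groupPath (List.Subset.refl _) hc ?_
      rw [wordValue_wordCode _ hj hi hk, hc]
    · refine hφ.eval_canonWord groupPath (List.Subset.refl _) rfl ?_
      rw [wordValue_wordCode _ hi hj hk]
  · obtain rfl := Nat.eq_of_beq_eq_true h
    have h0 : φ i i k = 0 := by
      have h2 : (2 : ℚ) • φ i i k = 0 := by
        rw [two_smul]
        nth_rw 1 [hφ.swap i i k]
        exact neg_add_cancel _
      exact (smul_eq_zero.mp h2).resolve_left two_ne_zero
    rw [h0, smul_zero, add_zero, cond_true]

theorem eval_foldr {α : Type} (ψ : ℕ → M) (f : α → WordTree → WordTree) (g : α → M) (l : List α)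
    (h : ∀ x ∈ l, ∀ T, (f x T).eval ψ = T.eval ψ + g x) (T : WordTree) :
    (l.foldr f T).eval ψ = T.eval ψ + (l.map g).sum := by
  induction l with
  | nil => simp
  | cons x l ih =>
    rw [List.forall_mem_cons] at h
    rw [List.foldr_cons, h.1, ih h.2, List.map_cons, List.sum_cons]
    abel

theorem IsSkew.eval_addTensor (hφ : IsSkew φ) (c : ℤ) {u v w : List (ℤ × ℕ)}
    (hu : ∀ p ∈ u, p.2 < 128) (hv : ∀ p ∈ v, p.2 < 128) (hw : ∀ p ∈ w, p.2 < 128)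
    (T : WordTree) :
    (addTensor c u v w T).eval (wordValue φ) = T.eval (wordValue φ) +
      (u.map fun p => (v.map fun q => (w.map fun r =>
        ((c * p.1 * q.1 * r.1 : ℤ) : ℚ) • φ p.2 q.2 r.2).sum).sum).sum :=
  eval_foldr _ _ _ _ (fun p hp => eval_foldr _ _ _ _ fun q hq => eval_foldr _ _ _ _
    fun r hr => hφ.eval_addWord _ (hu p hp) (hv q hq) (hw r hr)) T

end Evaluation

section Letters

/-- The class of the letter with a given index. -/
noncomputable def letterVal (i : ℕ) : VF K5 := letterClass (letterAt i)

theorem eq_of_eqLabels : ∀ {l m : List ℕ}, eqLabels l m = true → l = m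
  | [], [], _ => rfl
  | x :: l, y :: m, h => by
    rw [eqLabels, Bool.and_eq_true] at h
    rw [Nat.eq_of_beq_eq_true h.1, eq_of_eqLabels h.2]

/-- Tests whether the letter with index `i` is the normal form of `l`. -/
def isIndexOf (l : List ℕ) (i : ℕ) : Bool := eqLabels (canonLetter l) (letterAt i)

theorem letterVal_eq {l : List ℕ} {i : ℕ} (h : isIndexOf l i = true) :
    letterVal i = letterClass l := by
  rw [letterVal, ← eq_of_eqLabels h, letterClass_canonLetter]

/-- Tests the entries of `table p`. -/
def checkTable (p : ℕ) : Bool :=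
  (List.range 88).all fun i =>
    isIndexOf ((letterAt i).map (swapLabel p)) (digit (table p) i) &&
      (letterAt i).all fun x => Nat.blt x 10

/-- Tests the indices of the letters of a combination. -/
def checkIndices (u : LetterComb) : Bool :=
  u.all fun p => isIndexOf p.2 (letterIndex p.2) && Nat.blt (letterIndex p.2) 128

/-- Equality of Booleans, decided by computation. -/
instance boolDecEq : DecidableEq Bool := instDecidableEqBool

theorem checkTable_eq_true : ([1, 2, 5, 6].all checkTable) = true := by
  decide +kernel

theorem checkIndices_eq_true :
    (combs.all fun p => checkIndices p.2.1 && checkIndices p.2.2) = true := by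
  decide +kernel

theorem isZero_totalTree : totalTree.isZero = true := by
  decide +kernel

theorem mem_of_mem_groupPath {p : ℕ} (hp : p ∈ groupPath) : p ∈ [1, 2, 5, 6] := by
  simp only [groupPath, List.mem_cons, List.not_mem_nil, or_false] at hp ⊢
  omega

/-- The transposition of the vectors with labels `p` and `p + 1`. -/
def labelSwap (p : ℕ) : Equiv.Perm (Fin 10) := Equiv.swap (L10 p) (L10 (p + 1))

theorem L10_inj {x y : ℕ} (hx : x < 10) (hy : y < 10) : L10 x = L10 y ↔ x = y := by
  rw [L10, L10, Fin.mk.injEq]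
  omega

theorem labelSwap_L10 {p x : ℕ} (hp : p + 1 < 10) (hx : x < 10) :
    labelSwap p (L10 x) = L10 (swapLabel p x) := by
  rw [labelSwap, Equiv.swap_apply_def]
  simp only [L10_inj hx hp, L10_inj hx (Nat.lt_of_succ_lt hp), swapLabel]
  cases h : Nat.beq x p
  · rw [if_neg (Nat.ne_of_beq_eq_false h)]
    cases h' : Nat.beq x (p + 1)
    · rw [if_neg (Nat.ne_of_beq_eq_false h'), cond_false, cond_false]
    · rw [if_pos (Nat.eq_of_beq_eq_true h'), cond_false, cond_true]
  · rw [if_pos (Nat.eq_of_beq_eq_true h), cond_true]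

theorem fixSets_labelSwap {p : ℕ} (hp : p ∈ [1, 2, 5, 6]) : fixSets (labelSwap p) := by
  simp only [List.mem_cons, List.not_mem_nil, or_false] at hp
  refine ⟨fun i => ?_, fun i => ?_, fun i => ?_⟩ <;>
    rcases hp with rfl | rfl | rfl | rfl <;> fin_cases i <;>
    simp [labelSwap, L10, Equiv.swap_apply_def]

theorem vmap_letterVal {p : ℕ} (hp : p ∈ [1, 2, 5, 6]) (i : ℕ) :
    vmap (permAut 10 5 (labelSwap p)) (letterVal i) = letterVal (digit (table p) i) := by
  by_cases hi : i < 88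
  · have h := List.all_eq_true.mp (List.all_eq_true.mp checkTable_eq_true p hp) i
      (List.mem_range.mpr hi)
    rw [Bool.and_eq_true, List.all_eq_true] at h
    have hp' : p + 1 < 10 := by
      simp only [List.mem_cons, List.not_mem_nil, or_false] at hp
      omega
    rw [letterVal_eq h.1, letterVal, vmap_letterClass fun x hx =>
      labelSwap_L10 hp' (Nat.le_of_ble_eq_true (h.2 x hx))]
  · have ht : table p < 128 ^ 88 := by
      simp only [List.mem_cons, List.not_mem_nil, or_false] at hp
      rcases hp with rfl | rfl | rfl | rfl <;> norm_num [table]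
    have hd : digit (table p) i = 0 := by
      have h0 : table p / 128 ^ i = 0 :=
        Nat.div_eq_of_lt (ht.trans_le (Nat.pow_le_pow_right (by norm_num) (not_lt.mp hi)))
      change table p / 128 ^ i % 128 = 0
      rw [h0]
    have hl : letterAt i = [] := List.getD_eq_default _ _ (not_lt.mp hi)
    rw [hd, letterVal, hl]
    exact map_zero _

theorem isSkew_altTensor :
    IsSkew fun i j k => altTensor (letterVal i) (letterVal j) (letterVal k) where
  swap _ _ _ := altTensor_swap _ _ _
  transposition p hp i j k := by
    have hp' := mem_of_mem_groupPath hp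
    have hne : L10 p ≠ L10 (p + 1) := by
      simp only [List.mem_cons, List.not_mem_nil, or_false] at hp'
      rw [Ne, L10_inj] <;> omega
    simp only [← vmap_letterVal hp']
    exact altTensor_vmap_swap hne (fixSets_labelSwap hp') _ _ _

theorem eval_eq_sum_toIndices {u : LetterComb} (hu : checkIndices u = true) :
    u.eval = ((toIndices u).map fun p => (p.1 : ℚ) • letterVal p.2).sum := by
  rw [LetterComb.eval, toIndices, List.map_map]
  congr 1
  refine List.map_congr_left fun p hp => ?_
  have h := List.all_eq_true.mp hu p hp
  rw [Bool.and_eq_true] at h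
  rw [Function.comp_apply, letterVal_eq h.1]

theorem lt_of_mem_toIndices {u : LetterComb} (hu : checkIndices u = true) :
    ∀ p ∈ toIndices u, p.2 < 128 := by
  intro p hp
  obtain ⟨q, hq, rfl⟩ := List.mem_map.mp hp
  have h := List.all_eq_true.mp hu q hq
  rw [Bool.and_eq_true] at h
  exact Nat.le_of_ble_eq_true h.2

theorem map_sum_smul {V M : Type} [AddCommGroup V] [Module ℚ V] [AddCommGroup M] [Module ℚ M]
    (L : V →ₗ[ℚ] M) (f : ℕ → V) (u : List (ℤ × ℕ)) :
    L (u.map fun p => (p.1 : ℚ) • f p.2).sum = (u.map fun p => (p.1 : ℚ) • L (f p.2)).sum := by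
  induction u with
  | nil => exact map_zero L
  | cons p u ih => simp only [List.map_cons, List.sum_cons, map_add, map_smul, ih]

theorem smul_trilinear_sum {V M : Type} [AddCommGroup V] [Module ℚ V] [AddCommGroup M]
    [Module ℚ M] (B : V →ₗ[ℚ] V →ₗ[ℚ] V →ₗ[ℚ] M) (f : ℕ → V) (c : ℤ) (u v w : List (ℤ × ℕ)) :
    (c : ℚ) • B (u.map fun p => (p.1 : ℚ) • f p.2).sum (v.map fun p => (p.1 : ℚ) • f p.2).sum
      (w.map fun p => (p.1 : ℚ) • f p.2).sum =
    (u.map fun p => (v.map fun q => (w.map fun r =>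
      ((c * p.1 * q.1 * r.1 : ℤ) : ℚ) • B (f p.2) (f q.2) (f r.2)).sum).sum).sum := by
  have h₁ (y z : V) := map_sum_smul ((B.flip y).flip z) f u
  have h₂ (x z : V) := map_sum_smul ((B x).flip z) f v
  simp only [LinearMap.flip_apply] at h₁ h₂
  rw [h₁]
  simp only [h₂]
  simp only [map_sum_smul, List.smul_sum, List.map_map, Function.comp_def, smul_smul,
    Int.cast_mul, mul_assoc]

theorem altTensor_eval (c : ℤ) {u v w : LetterComb} (hu : checkIndices u = true)
    (hv : checkIndices v = true) (hw : checkIndices w = true) (T : WordTree) :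
    (addTensor c (toIndices u) (toIndices v) (toIndices w) T).eval
        (wordValue fun i j k => altTensor (letterVal i) (letterVal j) (letterVal k)) =
      T.eval (wordValue fun i j k => altTensor (letterVal i) (letterVal j) (letterVal k)) +
        (c : ℚ) • altTensor u.eval v.eval w.eval := by
  rw [isSkew_altTensor.eval_addTensor c (lt_of_mem_toIndices hu) (lt_of_mem_toIndices hv)
    (lt_of_mem_toIndices hw), eval_eq_sum_toIndices hu, eval_eq_sum_toIndices hv,
    eval_eq_sum_toIndices hw]
  rw [smul_trilinear_sum]

end Letters

theorem sum_altTensor_combs :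
    (combs.map fun p => (p.1 : ℚ) • altTensor p.2.2.eval p.2.1.eval p.2.2.eval).sum = 0 := by
  have h := WordTree.eval_eq_zero
    (wordValue fun i j k => altTensor (letterVal i) (letterVal j) (letterVal k)) isZero_totalTree
  rw [totalTree, eval_foldr _ _ (fun p => (p.1 : ℚ) • altTensor p.2.2.eval p.2.1.eval p.2.2.eval)]
    at h
  · simpa [WordTree.eval] using h
  · intro p hp T
    have hc := List.all_eq_true.mp checkIndices_eq_true p hp
    rw [Bool.and_eq_true] at hc
    exact altTensor_eval _ hc.2 hc.1 hc.2 T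

theorem sum_smul_list_sum {ι α M : Type} [AddCommGroup M] [Module ℚ M] (s : Finset ι) (a : ι → ℚ)
    (g : ι → α → M) (l : List (ℚ × α)) :
    ∑ i ∈ s, a i • (l.map fun p => p.1 • g i p.2).sum =
      (l.map fun p => p.1 • ∑ i ∈ s, a i • g i p.2).sum := by
  induction l with
  | nil => simp
  | cons p l ih =>
    simp only [List.map_cons, List.sum_cons, smul_add, Finset.sum_add_distrib, ih,
      Finset.smul_sum, smul_comm p.1]

theorem map_eq_map_of_forall₂ {α β γ : Type*} {R : α → β → Prop} {f : α → γ} {g : β → γ}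
    (h : ∀ x y, R x y → f x = g y) {l : List α} {m : List β} (hlm : List.Forall₂ R l m) :
    l.map f = m.map g := by
  induction hlm with
  | nil => rfl
  | cons hxy _ ih => rw [List.map_cons, List.map_cons, h _ _ hxy, ih]

theorem sum_Pit_SLi3 (x : K5) :
    ∑ σ ∈ Finset.univ.filter fixSets,
      (((Equiv.Perm.sign σ : ℤˣ) : ℤ) : ℚ) • Pit 3 (SLi3 (permAut 10 5 σ x)) =
        altTensor (cls x) (cls (1 - x)) (cls x) := by
  rw [altTensor_swap, altTensor_apply, ← Finset.sum_neg_distrib]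
  refine Finset.sum_congr rfl fun σ _ => ?_
  rw [← smul_neg, SLi3_eq, map_neg, Pit_pure3, ← cls_map, ← cls_map, map_sub, map_one]

end GrassPoly

/-- Lemma `gr5li3`: `Alt_{S_{{1,2,3}} × S_{{5,6,7}}} S^⧢ Li₃(𝒯) = 0`. -/
theorem li3_functional_equation :
    ∑ σ ∈ Finset.univ.filter fixSets,
      (((Equiv.Perm.sign σ : ℤˣ) : ℤ) : ℚ) •
        ((Tcal.map (fun p => p.1 • Pit 3 (SLi3 (permAut 10 5 σ p.2)))).sum) = 0 := by
  rw [sum_smul_list_sum _ _ (fun σ x => Pit 3 (SLi3 (permAut 10 5 σ x))), ← sum_altTensor_combs]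
  refine congrArg List.sum (map_eq_map_of_forall₂ (fun p q hpq => ?_) Tcal_combs)
  rw [sum_Pit_SLi3, hpq.1, hpq.2.1, hpq.2.2]
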